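/- There exists C > 0 such that for all j, j', j'', k, k', k'' ∈ ℕ satisfying k'' = max(k, k', k''), |j − j'| ≤ 2, and j'' ≤ min(j, j') − 3, and all Schwartz functions u, v on ℝ² with supp 𝓕u ⊆ R^+_{jk} and supp 𝓕v ⊆ R^−_{j'k'}, one has ‖ 1_{R^+_{j''k''}} · 𝓕(u v) ‖_{L²(ℝ²)} ≤ C 2^{k♭/2 + (k♮ − j♭)/2} ‖u‖_{L²(ℝ²)} ‖v‖_{L²(ℝ²)}, where k♭ = min(k,k',k''), k♮ is the median of (k,k',k''), and j♭ = min(j,j',j''). -/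

import Mathlib

open MeasureTheory SchwartzMap
open scoped ENNReal NNReal

noncomputable section

/-- Space–time Fourier transform on `ℝ²`, `(t,x) ↦ (τ,ξ)`. -/
def FT2 (u : ℝ × ℝ → ℂ) (q : ℝ × ℝ) : ℂ :=
  ∫ p : ℝ × ℝ,
    Complex.exp (-(2 * Real.pi * Complex.I) * ((p.1 * q.1 + p.2 * q.2 : ℝ) : ℂ)) * u p

/-- The dyadic space–time block `R^±_{jk}` (sign `ε = ±1`): spatial frequency
`2^{j-1} ≤ ε ξ ≤ 2^{j+1}` and modulation `2^{k-1} ≤ |τ - ε ξ²| ≤ 2^{k+1}`. -/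
def Rblock (ε : ℝ) (j k : ℕ) : Set (ℝ × ℝ) :=
  {q : ℝ × ℝ |
    (2 : ℝ) ^ ((j : ℝ) - 1) ≤ ε * q.2 ∧ ε * q.2 ≤ (2 : ℝ) ^ ((j : ℝ) + 1) ∧
    (2 : ℝ) ^ ((k : ℝ) - 1) ≤ |q.1 - ε * q.2 ^ 2| ∧
    |q.1 - ε * q.2 ^ 2| ≤ (2 : ℝ) ^ ((k : ℝ) + 1)}

/-- Minimum of a triple. -/
def min3 (a b c : ℕ) : ℕ := min a (min b c)

/-- Maximum of a triple. -/
def max3 (a b c : ℕ) : ℕ := max a (max b c)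

/-- Median of a triple. -/
def med3 (a b c : ℕ) : ℕ := a + b + c - min3 a b c - max3 a b c

open FourierTransform

theorem sq_lintegral_le_measure_support_mul {α : Type*} [MeasurableSpace α] {μ : Measure α}
    {f : α → ℝ≥0∞} (hf : Measurable f) :
    (∫⁻ x, f x ∂μ) ^ 2 ≤ μ (Function.support f) * ∫⁻ x, f x ^ 2 ∂μ := by
  have hs : MeasurableSet (Function.support f) := measurableSet_support hf
  have h := ENNReal.lintegral_mul_le_Lp_mul_Lq μ Real.HolderConjugate.two_two
    ((measurable_const (a := (1 : ℝ≥0∞))).indicator hs).aemeasurable hf.aemeasurable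
  have h1 : ∀ x, ((Function.support f).indicator (fun _ => (1 : ℝ≥0∞)) * f) x = f x := by
    intro x
    by_cases hx : x ∈ Function.support f
    · simp [hx]
    · simp [hx, Function.notMem_support.1 hx]
  have h2 : ∀ x, (Function.support f).indicator (fun _ => (1 : ℝ≥0∞)) x ^ (2 : ℝ)
      = (Function.support f).indicator (fun _ => (1 : ℝ≥0∞)) x := by
    intro x
    by_cases hx : x ∈ Function.support f <;> simp [hx]
  simp only [h1, h2, lintegral_indicator hs, lintegral_const, one_mul,
    Measure.restrict_apply_univ, ENNReal.rpow_ofNat] at h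
  calc (∫⁻ x, f x ∂μ) ^ 2
      ≤ (μ (Function.support f) ^ (1 / 2 : ℝ) * (∫⁻ x, f x ^ 2 ∂μ) ^ (1 / 2 : ℝ)) ^ 2 := by
        gcongr
    _ = μ (Function.support f) * ∫⁻ x, f x ^ 2 ∂μ := by
        rw [mul_pow, ← ENNReal.rpow_natCast, ← ENNReal.rpow_natCast, ← ENNReal.rpow_mul,
          ← ENNReal.rpow_mul]
        norm_num

theorem eLpNorm_two_sq {α : Type*} [MeasurableSpace α] {μ : Measure α} (f : α → ℂ) :
    eLpNorm f 2 μ ^ 2 = ∫⁻ x, ‖f x‖ₑ ^ 2 ∂μ := by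
  have h := eLpNorm_nnreal_pow_eq_lintegral (μ := μ) (f := f) (p := 2) two_ne_zero
  simpa using h

theorem lintegral_lintegral_mul_sub {f g : ℝ × ℝ → ℝ≥0∞} (hf : Measurable f)
    (hg : Measurable g) :
    ∫⁻ q, ∫⁻ p, f p * g (q - p) = (∫⁻ p, f p) * ∫⁻ p, g p := by
  rw [lintegral_lintegral_swap (by fun_prop), ← lintegral_mul_const _ hf]
  refine lintegral_congr fun p => ?_
  rw [lintegral_const_mul _ (by fun_prop), lintegral_sub_right_eq_self g p]

/-- Schur-type bound: a convolution is controlled in `L²(S)` by the measure of the sets on which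
its integrand lives. -/
theorem eLpNorm_indicator_integral_mul_sub_le {f g : ℝ × ℝ → ℂ} (hf : Continuous f)
    (hg : Continuous g) {S : Set (ℝ × ℝ)} {M : ℝ≥0∞}
    (hM : ∀ q ∈ S, volume {p | f p ≠ 0 ∧ g (q - p) ≠ 0} ≤ M ^ 2) :
    eLpNorm (S.indicator fun q => ∫ p, f p * g (q - p)) 2 volume
      ≤ M * eLpNorm f 2 volume * eLpNorm g 2 volume := by
  rw [← ENNReal.pow_le_pow_left_iff two_ne_zero]
  rw [mul_pow, mul_pow, eLpNorm_two_sq, eLpNorm_two_sq, eLpNorm_two_sq, mul_assoc,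
    ← lintegral_lintegral_mul_sub (by fun_prop) (by fun_prop),
    ← lintegral_const_mul _ (by fun_prop)]
  refine lintegral_mono fun q => ?_
  by_cases hq : q ∈ S
  · rw [Set.indicator_of_mem hq]
    calc ‖∫ p, f p * g (q - p)‖ₑ ^ 2
        ≤ (∫⁻ p, ‖f p * g (q - p)‖ₑ) ^ 2 := by
          gcongr
          exact enorm_integral_le_lintegral_enorm _
      _ ≤ volume (Function.support fun p => ‖f p * g (q - p)‖ₑ)
            * ∫⁻ p, ‖f p * g (q - p)‖ₑ ^ 2 :=
          sq_lintegral_le_measure_support_mul (by fun_prop)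
      _ ≤ M ^ 2 * ∫⁻ p, ‖f p‖ₑ ^ 2 * ‖g (q - p)‖ₑ ^ 2 := by
          simp only [enorm_mul, mul_pow]
          gcongr
          refine le_trans (measure_mono fun p hp => ?_) (hM q hq)
          simpa using hp
  · simp [hq]

/-- A Schwartz function on `ℝ × ℝ`, regarded as one on the Euclidean plane. -/
def toPlane (u : 𝓢(ℝ × ℝ, ℂ)) : 𝓢(WithLp 2 (ℝ × ℝ), ℂ) :=
  compCLMOfContinuousLinearEquiv ℂ (WithLp.prodContinuousLinearEquiv 2 ℝ ℝ ℝ) u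

theorem toPlane_apply (u : 𝓢(ℝ × ℝ, ℂ)) (x : WithLp 2 (ℝ × ℝ)) : toPlane u x = u x.ofLp := rfl

theorem FT2_eq_fourier (u : 𝓢(ℝ × ℝ, ℂ)) (q : ℝ × ℝ) :
    FT2 u q = 𝓕 (toPlane u) (WithLp.toLp 2 q) := by
  rw [fourier_coe, Real.fourier_eq', FT2,
    ← (WithLp.volume_preserving_ofLp ℝ ℝ).integral_comp
      (MeasurableEquiv.toLp 2 (ℝ × ℝ)).symm.measurableEmbedding]
  refine integral_congr_ae (.of_forall fun x => ?_)
  simp only [smul_eq_mul, toPlane_apply, WithLp.prod_inner_apply]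
  congr 2
  simp
  ring

theorem continuous_FT2 (u : 𝓢(ℝ × ℝ, ℂ)) : Continuous (FT2 u) := by
  rw [funext (FT2_eq_fourier u)]
  exact (𝓕 (toPlane u)).continuous.comp (WithLp.prod_continuous_toLp 2 ℝ ℝ)

theorem eLpNorm_fourier {V : Type*} [NormedAddCommGroup V] [InnerProductSpace ℝ V]
    [FiniteDimensional ℝ V] [MeasurableSpace V] [BorelSpace V] (f : 𝓢(V, ℂ)) :
    eLpNorm (𝓕 f : 𝓢(V, ℂ)) 2 volume = eLpNorm f 2 volume := by
  have h := norm_fourier_toL2_eq f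
  rw [norm_toLp, norm_toLp] at h
  exact (ENNReal.toReal_eq_toReal_iff' ((𝓕 f : 𝓢(V, ℂ)).memLp 2 volume).eLpNorm_ne_top
    (f.memLp 2 volume).eLpNorm_ne_top).1 h

theorem eLpNorm_FT2 (u : 𝓢(ℝ × ℝ, ℂ)) :
    eLpNorm (FT2 u) 2 volume = eLpNorm u 2 volume := by
  rw [funext (FT2_eq_fourier u)]
  have h1 := eLpNorm_comp_measurePreserving (p := 2)
    (𝓕 (toPlane u)).continuous.aestronglyMeasurable (WithLp.volume_preserving_toLp ℝ ℝ)
  have h2 := eLpNorm_comp_measurePreserving (p := 2)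
    u.continuous.aestronglyMeasurable (WithLp.volume_preserving_ofLp ℝ ℝ)
  exact h1.trans ((eLpNorm_fourier _).trans h2)

theorem fourier_pairing_mul {V : Type*} [NormedAddCommGroup V] [InnerProductSpace ℝ V]
    [FiniteDimensional ℝ V] [MeasurableSpace V] [BorelSpace V] (f g : 𝓢(V, ℂ)) (ξ : V) :
    𝓕 (pairing (ContinuousLinearMap.mul ℂ ℂ) f g) ξ = ∫ η, 𝓕 f η * 𝓕 g (ξ - η) := by
  have h : pairing (ContinuousLinearMap.mul ℂ ℂ) f g
      = 𝓕⁻ (SchwartzMap.convolution (ContinuousLinearMap.mul ℂ ℂ) (𝓕 f) (𝓕 g)) := by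
    ext x
    have hinv : ∀ w : 𝓢(V, ℂ), 𝓕 (𝓕 w) (-x) = w x := by
      intro w
      have : 𝓕⁻ (𝓕 w) x = w x := by simp
      rwa [fourierInv_apply_eq] at this
    rw [fourierInv_apply_eq, fourier_convolution]
    simp [pairing_apply_apply, hinv]
  rw [h, FourierTransform.fourier_fourierInv_eq, convolution_apply]
  rfl

theorem FT2_mul (u v : 𝓢(ℝ × ℝ, ℂ)) (q : ℝ × ℝ) :
    FT2 (fun p => u p * v p) q = ∫ p, FT2 u p * FT2 v (q - p) := by
  have h := FT2_eq_fourier (pairing (ContinuousLinearMap.mul ℂ ℂ) u v) q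
  have hp : toPlane (pairing (ContinuousLinearMap.mul ℂ ℂ) u v)
      = pairing (ContinuousLinearMap.mul ℂ ℂ) (toPlane u) (toPlane v) := rfl
  rw [hp, fourier_pairing_mul] at h
  rw [show (fun p => u p * v p) = ⇑(pairing (ContinuousLinearMap.mul ℂ ℂ) u v) from rfl, h,
    ← (WithLp.volume_preserving_ofLp ℝ ℝ).integral_comp
      (MeasurableEquiv.toLp 2 (ℝ × ℝ)).symm.measurableEmbedding]
  simp only [FT2_eq_fourier]
  rfl

/-- Pairs of points near the parabolas `τ = ξ²` and `τ = -ξ²` adding up to a given point `q` of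
positive frequency at least `N`. -/
theorem volume_parabola_strip_inter_le {a b N : ℝ} (hab : 0 ≤ a + b) (hN : 0 < N) (q : ℝ × ℝ) (hq : N ≤ q.2) :
    volume {p : ℝ × ℝ | |p.1 - p.2 ^ 2| ≤ a ∧ |q.1 - p.1 + (q.2 - p.2) ^ 2| ≤ b}
      ≤ ENNReal.ofReal ((a + b) / N) * ENNReal.ofReal (2 * min a b) := by
  set A := {p : ℝ × ℝ | |p.1 - p.2 ^ 2| ≤ a ∧ |q.1 - p.1 + (q.2 - p.2) ^ 2| ≤ b}
  have hA : MeasurableSet A := by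
    simp only [A, Set.ofPred_and]
    exact (measurableSet_le (by fun_prop) (by fun_prop)).inter
      (measurableSet_le (by fun_prop) (by fun_prop))
  have hq0 : 0 < q.2 := hN.trans_le hq
  set c := (q.1 + q.2 ^ 2) / (2 * q.2)
  set r := (a + b) / (2 * q.2)
  have hfib : ∀ y, volume ((fun x => (x, y)) ⁻¹' A)
      ≤ (Set.Icc (c - r) (c + r)).indicator (fun _ => ENNReal.ofReal (2 * min a b)) y := by
    intro y
    by_cases hy : y ∈ Set.Icc (c - r) (c + r)
    · rw [Set.indicator_of_mem hy]
      rcases le_total a b with h | h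
      · rw [min_eq_left h]
        refine (measure_mono (t := Set.Icc (y ^ 2 - a) (y ^ 2 + a)) fun x hx => ?_).trans_eq ?_
        · have := abs_le.1 hx.1
          constructor <;> linarith [this.1, this.2]
        · rw [Real.volume_Icc]; ring_nf
      · rw [min_eq_right h]
        refine (measure_mono (t := Set.Icc (q.1 + (q.2 - y) ^ 2 - b) (q.1 + (q.2 - y) ^ 2 + b))
          fun x hx => ?_).trans_eq ?_
        · have := abs_le.1 hx.2
          constructor <;> linarith [this.1, this.2]
        · rw [Real.volume_Icc]; ring_nf
    · rw [Set.indicator_of_notMem hy, nonpos_iff_eq_zero]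
      refine measure_mono_null ?_ (measure_empty (μ := volume))
      refine (Set.eq_empty_of_forall_notMem fun x hx => hy ?_).subset
      have h1 := abs_le.1 hx.1
      have h2 := abs_le.1 hx.2
      simp only at h1 h2
      constructor
      · rw [← sub_div, div_le_iff₀ (by positivity)]; linarith [h1.1, h1.2, h2.1, h2.2]
      · rw [← add_div, le_div_iff₀ (by positivity)]; linarith [h1.1, h1.2, h2.1, h2.2]
  rw [Measure.volume_eq_prod, Measure.prod_apply_symm hA]
  refine (lintegral_mono hfib).trans ?_
  rw [lintegral_indicator measurableSet_Icc, setLIntegral_const, Real.volume_Icc, mul_comm]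
  gcongr
  calc c + r - (c - r) = (a + b) / q.2 := by simp only [r]; field_simp; ring
    _ ≤ (a + b) / N := by gcongr

/-- **Conormal bilinear block estimate, `(+,-)` interactions, remainder case
`j'' ≪ j ∼ j'`, dominant modulation `k'' = k♯`**:
`‖1_{R^+_{j''k''}} 𝓕(uv)‖_{L²} ≲ 2^{k♭/2 + (k♮-j♭)/2} ‖u‖_{L²} ‖v‖_{L²}`. -/
theorem bilinear_block_conormal_pm_remainder :
    ∃ C : ℝ, 0 < C ∧
      ∀ (j j' j'' k k' k'' : ℕ),
        k'' = max3 k k' k'' →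
        |(j : ℤ) - (j' : ℤ)| ≤ 2 →
        j'' + 3 ≤ min j j' →
        ∀ (u v : 𝓢(ℝ × ℝ, ℂ)),
          Function.support (FT2 ⇑u) ⊆ Rblock 1 j k →
          Function.support (FT2 ⇑v) ⊆ Rblock (-1) j' k' →
          eLpNorm ((Rblock 1 j'' k'').indicator (FT2 fun p => u p * v p)) 2
              (volume : Measure (ℝ × ℝ))
            ≤ ENNReal.ofReal
                (C * (2 : ℝ) ^ ((min3 k k' k'' : ℝ) / 2 +
                  ((med3 k k' k'' : ℝ) - (min3 j j' j'' : ℝ)) / 2)) *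
              eLpNorm (⇑u) 2 (volume : Measure (ℝ × ℝ)) *
              eLpNorm (⇑v) 2 (volume : Measure (ℝ × ℝ)) := by
  refine ⟨6, by norm_num, ?_⟩
  intro j j' j'' k k' k'' hk hj hj'' u v hu hv
  rw [← eLpNorm_FT2 u, ← eLpNorm_FT2 v, funext (FT2_mul u v)]
  refine eLpNorm_indicator_integral_mul_sub_le (continuous_FT2 u) (continuous_FT2 v)
    fun q hq => ?_
  set a : ℝ := 2 ^ ((k : ℝ) + 1)
  set b : ℝ := 2 ^ ((k' : ℝ) + 1)
  set N : ℝ := 2 ^ ((j'' : ℝ) - 1)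
  have ha0 : 0 < a := by positivity
  have hb0 : 0 < b := by positivity
  have hN0 : 0 < N := by positivity
  have hsub : {p | FT2 u p ≠ 0 ∧ FT2 v (q - p) ≠ 0}
      ⊆ {p : ℝ × ℝ | |p.1 - p.2 ^ 2| ≤ a ∧ |q.1 - p.1 + (q.2 - p.2) ^ 2| ≤ b} := by
    rintro p ⟨hp, hp'⟩
    have h1 := (hu hp).2.2.2
    have h2 := (hv hp').2.2.2
    simp only [one_mul, Prod.fst_sub, Prod.snd_sub, neg_mul, sub_neg_eq_add] at h1 h2
    exact ⟨h1, h2⟩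
  refine (measure_mono hsub).trans ((volume_parabola_strip_inter_le (by positivity) hN0 q
    (by simpa using hq.1)).trans ?_)
  rw [← ENNReal.ofReal_mul (by positivity), ← ENNReal.ofReal_pow (by positivity)]
  refine ENNReal.ofReal_le_ofReal ?_
  have hexp : (min3 k k' k'' : ℝ) + (med3 k k' k'' : ℝ) = k + k' := by
    have : min3 k k' k'' + med3 k k' k'' = k + k' := by
      simp only [min3, med3, max3] at hk ⊢
      omega
    exact_mod_cast this
  have hmin : min3 j j' j'' = j'' := by
    simp only [min3]
    omega
  have hpow : a * b / N
      = 8 * (2 : ℝ) ^ (((min3 k k' k'' : ℝ) / 2 +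
        ((med3 k k' k'' : ℝ) - (min3 j j' j'' : ℝ)) / 2) * (2 : ℕ)) := by
    rw [hmin, show (8 : ℝ) = 2 ^ (3 : ℝ) by norm_num, ← Real.rpow_add two_pos,
      ← Real.rpow_add two_pos, ← Real.rpow_sub two_pos]
    congr 1
    push_cast
    linarith
  calc (a + b) / N * (2 * min a b) ≤ (2 * max a b) / N * (2 * min a b) := by
        gcongr
        linarith [le_max_left a b, le_max_right a b]
    _ = 4 * (a * b / N) := by rw [← min_mul_max a b]; ring
    _ ≤ _ := by
        rw [hpow, mul_pow, ← Real.rpow_mul_natCast two_pos.le]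
        have : (0 : ℝ) < 2 ^ (((min3 k k' k'' : ℝ) / 2 +
          ((med3 k k' k'' : ℝ) - (min3 j j' j'' : ℝ)) / 2) * (2 : ℕ)) := by positivity
        linarith

end
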